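/- arXiv:2104.11987 — 3 statements merged into one kernel-verified Lean document; each statement's English description precedes it below -/
import Mathlib

section
/- Let 2/3 < r < 2, δ > 0, and t₀ > 0. Let H be a real Hilbert space, f : H → ℝ convex and differentiable with ∇f Lipschitz continuous on bounded sets, argmin f nonempty, and let x* be the element of minimum norm of argmin f. Let x : [t₀, ∞) → H be a twice differentiable solution of ẍ(t) + (δ/t^{r/2}) ẋ(t) + ∇f(x(t)) + (1/t^r) x(t) = 0 on [t₀, ∞). Then liminf_{t → ∞} ‖x(t) − x*‖ = 0. Moreover, if there exists T ≥ t₀ such that either ‖x(t)‖ < ‖x*‖ for all t ≥ T, or ‖x(t)‖ ≥ ‖x*‖ for all t ≥ T, then x(t) converges strongly to x* as t → ∞. -/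
open Filter Set

section

open scoped RealInnerProductSpace

variable {H : Type*} [NormedAddCommGroup H] [InnerProductSpace ℝ H]

/-- A differentiable convex function lies above its tangent hyperplanes. -/
theorem ConvexOn.add_inner_gradient_le [CompleteSpace H] {f : H → ℝ} {g x : H}
    (hconv : ConvexOn ℝ univ f) (hg : HasGradientAt f g x) (y : H) :
    f x + ⟪g, y - x⟫ ≤ f y := by
  have hline : ConvexOn ℝ univ (fun τ : ℝ => f (AffineMap.lineMap x y τ)) := by
    exact hconv.comp_affineMap (AffineMap.lineMap (k := ℝ) x y)
  have hd : HasDerivAt (fun τ : ℝ => f (AffineMap.lineMap x y τ)) ⟪g, y - x⟫ 0 := by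
    have h0 : HasFDerivAt f (InnerProductSpace.toDual ℝ H g)
        (AffineMap.lineMap (k := ℝ) x y (0 : ℝ)) := by
      simpa using hg.hasFDerivAt
    exact h0.comp_hasDerivAt (0 : ℝ)
      (AffineMap.hasDerivAt_lineMap (𝕜 := ℝ) (a := x) (b := y) (x := 0))
  have := hline.le_slope_of_hasDerivAt (mem_univ 0) (mem_univ 1) zero_lt_one hd
  simp [slope_def_field] at this
  linarith

/-- Almost minimizers of `f` have norm almost as large as the minimum norm minimizer. -/
theorem exists_norm_sq_sub_lt_of_le_add [CompleteSpace H] {f : H → ℝ}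
    (hconv : ConvexOn ℝ univ f) (hcont : Continuous f) {p : H} (hmin : ∀ y, f p ≤ f y)
    (hnorm : ∀ y, (∀ z, f y ≤ f z) → ‖p‖ ≤ ‖y‖) {e : ℝ} (he : 0 < e) :
    ∃ η > 0, ∀ y, f y ≤ f p + η → ‖p‖ ^ 2 - e < ‖y‖ ^ 2 := by
  let C : ℕ → Set H := fun n => {y | f y ≤ f p + 1 / ((n : ℝ) + 1)}
  have hpC : ∀ n, p ∈ C n := fun n => by
    have : (0 : ℝ) < 1 / ((n : ℝ) + 1) := Nat.one_div_pos_of_nat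
    simp only [C, mem_ofPred_eq]; linarith
  have hconvC : ∀ n, Convex ℝ (C n) := fun n => by
    simpa [C] using hconv.convex_le (f p + 1 / ((n : ℝ) + 1))
  have hclosed : ∀ n, IsClosed (C n) := fun n => isClosed_le hcont continuous_const
  have hanti : ∀ {m n : ℕ}, m ≤ n → C n ⊆ C m := fun {m n} hmn y hy =>
    le_trans (show f y ≤ f p + 1 / ((n : ℝ) + 1) from hy) (by gcongr)
  have hproj : ∀ n, ∃ v ∈ C n, ∀ w ∈ C n, ‖w - v‖ ^ 2 ≤ ‖w‖ ^ 2 - ‖v‖ ^ 2 := fun n => by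
    obtain ⟨v, hv, hvmin⟩ := exists_norm_eq_iInf_of_complete_convex ⟨p, hpC n⟩
      (hclosed n).isComplete (hconvC n) 0
    refine ⟨v, hv, fun w hw => ?_⟩
    have h := (norm_eq_iInf_iff_real_inner_le_zero (hconvC n) hv).1 hvmin w hw
    rw [zero_sub, inner_neg_left, inner_sub_right, real_inner_self_eq_norm_sq] at h
    rw [norm_sub_sq_real, real_inner_comm]
    linarith
  choose v hv hvw using hproj
  have hmono : Monotone fun n => ‖v n‖ ^ 2 := fun m n hmn => by
    have := hvw m (v n) (hanti hmn (hv n))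
    have := sq_nonneg ‖v n - v m‖
    simp only; linarith
  have hbdd : ∀ n, ‖v n‖ ^ 2 ≤ ‖p‖ ^ 2 := fun n => by
    have := hvw n p (hpC n)
    have := sq_nonneg ‖p - v n‖
    linarith
  have hlim := tendsto_atTop_ciSup hmono ⟨‖p‖ ^ 2, by rintro _ ⟨n, rfl⟩; exact hbdd n⟩
  have hcauchy : CauchySeq v := by
    rw [Metric.cauchySeq_iff']
    intro b hb
    obtain ⟨N, hN⟩ := (Metric.cauchySeq_iff'.1 hlim.cauchySeq) (b ^ 2) (by positivity)
    refine ⟨N, fun n hn => ?_⟩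
    have h1 := hvw N (v n) (hanti hn (hv n))
    have h2 := lt_of_le_of_lt (le_abs_self _) (hN n hn)
    rw [dist_eq_norm]
    exact lt_of_pow_lt_pow_left₀ 2 hb.le (by linarith)
  obtain ⟨y, hy⟩ := cauchySeq_tendsto_of_complete hcauchy
  have hfy : f y ≤ f p := by
    have h1 : Tendsto (fun n : ℕ => f p + 1 / ((n : ℝ) + 1)) atTop (nhds (f p + 0)) :=
      tendsto_const_nhds.add tendsto_one_div_add_atTop_nhds_zero_nat
    rw [add_zero] at h1
    exact le_of_tendsto_of_tendsto' ((hcont.tendsto y).comp hy) h1 hv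
  have hpy : ‖p‖ ≤ ‖y‖ := hnorm y fun z => hfy.trans (hmin z)
  have hsq : ‖p‖ ^ 2 - e < ‖y‖ ^ 2 := by
    have := pow_le_pow_left₀ (norm_nonneg p) hpy 2
    linarith
  obtain ⟨n, hn⟩ := ((hy.norm.pow 2).eventually (lt_mem_nhds hsq)).exists
  refine ⟨1 / ((n : ℝ) + 1), Nat.one_div_pos_of_nat, fun w hw => ?_⟩
  have := hvw n w hw
  have := sq_nonneg ‖w - v n‖
  linarith

/-- A point which almost minimizes `f` and whose norm is almost at most that of the minimum norm
minimizer is close to it. -/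
theorem exists_norm_sub_lt_of_le_add [CompleteSpace H] {f : H → ℝ}
    (hconv : ConvexOn ℝ univ f) (hcont : Continuous f) {p : H} (hmin : ∀ y, f p ≤ f y)
    (hnorm : ∀ y, (∀ z, f y ≤ f z) → ‖p‖ ≤ ‖y‖) {e : ℝ} (he : 0 < e) :
    ∃ η > 0, ∀ y, f y ≤ f p + η → ‖y‖ ^ 2 ≤ ‖p‖ ^ 2 + η → ‖y - p‖ < e := by
  obtain ⟨η, hη, h⟩ := exists_norm_sq_sub_lt_of_le_add hconv hcont hmin hnorm
    (e := e ^ 2 / 8) (by positivity)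
  refine ⟨min η (e ^ 2 / 4), by positivity, fun y hy hy' => ?_⟩
  have h1 := min_le_left η (e ^ 2 / 4)
  have h2 := min_le_right η (e ^ 2 / 4)
  have hmid : f ((1 / 2 : ℝ) • y + (1 / 2 : ℝ) • p) ≤ f p + η := by
    have := hconv.2 (mem_univ y) (mem_univ p)
      (by norm_num : (0 : ℝ) ≤ 1 / 2) (by norm_num : (0 : ℝ) ≤ 1 / 2) (by norm_num)
    simp only [smul_eq_mul] at this
    linarith
  have h3 := h _ hmid
  rw [← smul_add, norm_smul, mul_pow] at h3
  have h4 := parallelogram_law_with_norm ℝ y p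
  norm_num at h3
  refine lt_of_pow_lt_pow_left₀ 2 he.le ?_
  nlinarith

/-- The pointwise dissipation estimate for the Lyapunov function of the damped inertial system,
where `s` is the square root of the Tikhonov parameter and `-ρ s²` is the derivative of `s`. -/
theorem dissipation_nonpos {c δ s ρ η F : ℝ} {p x v g a : H}
    (hc : 0 < c) (hc2 : c ≤ 1 / 2) (hcδ : 2 * c ≤ δ) (hcδ' : c * δ ≤ 1 / 2) (hs : 0 < s)
    (hρ : 0 < ρ) (hρ2 : ρ ≤ 1 / 2) (hρη : ρ * (2 * η + ‖p‖ ^ 2) ≤ c * η)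
    (hF : F ≤ ⟪g, x - p⟫) (ha : a + (δ * s) • v + g + (s ^ 2) • x = 0) :
    c * s * (F + s ^ 2 / 2 * (⟪x, x⟫ - ‖p‖ ^ 2) + c * δ / 2 * s ^ 2 * ⟪x - p, x - p⟫
        + c * s * ⟪x - p, v⟫ + ⟪v, v⟫ / 2 - η * s ^ 2)
      + (⟪g, v⟫ + s * (-ρ * s ^ 2) * (⟪x, x⟫ - ‖p‖ ^ 2) + s ^ 2 * ⟪x, v⟫
        + c * δ * s * (-ρ * s ^ 2) * ⟪x - p, x - p⟫ + c * δ * s ^ 2 * ⟪x - p, v⟫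
        + c * (-ρ * s ^ 2) * ⟪x - p, v⟫ + c * s * (⟪v, v⟫ + ⟪x - p, a⟫) + ⟪v, a⟫
        - η * (2 * s * (-ρ * s ^ 2))) ≤ 0 := by
  obtain rfl : a = -((δ * s) • v + g + (s ^ 2) • x) := by
    rw [eq_neg_iff_add_eq_zero, ← ha]; abel
  obtain ⟨z, rfl⟩ : ∃ z, x = z + p := ⟨x - p, by simp⟩
  rw [add_sub_cancel_right] at *
  have hδ : 0 < δ := by linarith
  have hz : 0 ≤ ⟪z, z⟫ := real_inner_self_nonneg
  have hx : 0 ≤ ⟪z + p, z + p⟫ := real_inner_self_nonneg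
  have hv : 0 ≤ ⟪v, v⟫ := real_inner_self_nonneg
  have hp1 : 0 ≤ s ^ 2 * ⟪z, z⟫ + 2 * s * ⟪z, v⟫ + ⟪v, v⟫ := by
    have := real_inner_self_nonneg (x := s • z + v)
    simp only [inner_add_left, inner_add_right, real_inner_smul_left, real_inner_smul_right,
      real_inner_comm z v] at this
    linarith
  have hp2 : 0 ≤ s ^ 2 * ⟪z, z⟫ - 2 * s * ⟪z, v⟫ + ⟪v, v⟫ := by
    have := real_inner_self_nonneg (x := s • z - v)
    simp only [inner_sub_left, inner_sub_right, real_inner_smul_left, real_inner_smul_right,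
      real_inner_comm z v] at this
    linarith
  have hcross : (c - ρ) * (s * ⟪z, v⟫) ≤ 1 / 4 * (s ^ 2 * ⟪z, z⟫ + ⟪v, v⟫) := by
    have h1 : |c - ρ| ≤ 1 / 2 := abs_le.2 ⟨by linarith, by linarith⟩
    have h2 : |s * ⟪z, v⟫| ≤ (s ^ 2 * ⟪z, z⟫ + ⟪v, v⟫) / 2 :=
      abs_le.2 ⟨by linarith, by linarith⟩
    calc _ ≤ |c - ρ| * |s * ⟪z, v⟫| := by rw [← abs_mul]; exact le_abs_self _
      _ ≤ 1 / 2 * ((s ^ 2 * ⟪z, z⟫ + ⟪v, v⟫) / 2) := by gcongr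
      _ = _ := by ring
  have e1 := mul_le_mul_of_nonneg_left hcross (mul_pos hc hs).le
  have e2 := mul_le_mul_of_nonneg_left hρη (pow_pos hs 3).le
  have e3 := mul_le_mul_of_nonneg_left hF (mul_pos hc hs).le
  have e4 : 0 ≤ s ^ 3 * ρ * ⟪z + p, z + p⟫ := by positivity
  have e5 : 0 ≤ c * δ * s ^ 3 * ρ * ⟪z, z⟫ := by positivity
  have e6 : 0 ≤ s * ⟪v, v⟫ * (δ - 2 * c) :=
    mul_nonneg (by positivity) (by linarith)
  have e7 : 0 ≤ c * s ^ 3 * ⟪z, z⟫ * (1 / 2 - c * δ) :=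
    mul_nonneg (by positivity) (by linarith)
  have e8 : 0 ≤ c * s * ⟪v, v⟫ := by positivity
  have hpp := real_inner_self_eq_norm_sq p
  simp only [inner_add_left, inner_add_right, inner_neg_right, real_inner_smul_right,
    real_inner_comm z v, real_inner_comm z p, real_inner_comm v g, real_inner_comm v p,
    real_inner_comm z g, hpp] at *
  nlinarith

theorem tendsto_rpow_mul_exp_neg_mul_rpow {κ β : ℝ} (hκ : 0 < κ) (hβ : 0 < β) (r : ℝ) :
    Tendsto (fun t : ℝ => t ^ r * Real.exp (-κ * t ^ β)) atTop (nhds 0) := by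
  refine ((tendsto_rpow_mul_exp_neg_mul_atTop_nhds_zero (r / β) κ hκ).comp
    (tendsto_rpow_atTop hβ)).congr' ?_
  filter_upwards [eventually_ge_atTop 0] with t ht
  simp only [Function.comp]
  rw [← Real.rpow_mul ht, mul_div_cancel₀ _ hβ.ne']

end

/-- The regularized gap at the minimum norm solution is negligible with respect to the Tikhonov
parameter, along every trajectory. -/
theorem eventually_gap_le
    {H : Type*} [NormedAddCommGroup H] [InnerProductSpace ℝ H] [CompleteSpace H]
    {f : H → ℝ} {f' : H → H} (hconv : ConvexOn ℝ univ f) (hgrad : ∀ y, HasGradientAt f (f' y) y)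
    (p : H) {r δ t₀ : ℝ} (hr0 : 0 < r) (hr2 : r < 2) (hδ : 0 < δ) (ht₀ : 0 < t₀)
    {x x' x'' : ℝ → H}
    (hx1 : ∀ t, t₀ ≤ t → HasDerivAt x (x' t) t)
    (hx2 : ∀ t, t₀ ≤ t → HasDerivAt x' (x'' t) t)
    (hode : ∀ t, t₀ ≤ t →
      x'' t + (δ / t ^ (r / 2)) • x' t + f' (x t) + (1 / t ^ r) • x t = 0)
    {η : ℝ} (hη : 0 < η) :
    ∀ᶠ t in atTop, f (x t) - f p + t ^ (-r) / 2 * (‖x t‖ ^ 2 - ‖p‖ ^ 2) ≤ 2 * η * t ^ (-r) := by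
  obtain ⟨c, hc, hc2, hcδ, hcδ'⟩ : ∃ c : ℝ, 0 < c ∧ c ≤ 1 / 2 ∧ 2 * c ≤ δ ∧ c * δ ≤ 1 / 2 := by
    refine ⟨min (1 / 2) (min (δ / 2) (1 / (2 * δ))), by positivity, min_le_left _ _, ?_, ?_⟩
    · have := (min_le_right (1 / 2) (min (δ / 2) (1 / (2 * δ)))).trans (min_le_left _ _)
      linarith
    · have := (min_le_right (1 / 2) (min (δ / 2) (1 / (2 * δ)))).trans (min_le_right _ _)
      calc _ ≤ 1 / (2 * δ) * δ := by gcongr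
        _ = 1 / 2 := by field_simp
  set β : ℝ := 1 - r / 2 with hβ
  have hβ0 : 0 < β := by rw [hβ]; linarith
  let s : ℝ → ℝ := fun t => t ^ (-(r / 2))
  let ρ : ℝ → ℝ := fun t => r / 2 * t ^ (-β)
  let W : ℝ → ℝ := fun t => f (x t) - f p + s t ^ 2 / 2 * (inner ℝ (x t) (x t) - ‖p‖ ^ 2)
    + c * δ / 2 * s t ^ 2 * inner ℝ (x t - p) (x t - p)
    + c * s t * inner ℝ (x t - p) (x' t) + inner ℝ (x' t) (x' t) / 2 - η * s t ^ 2
  let θ : ℝ → ℝ := fun t => Real.exp (c / β * t ^ β)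
  have hs0 : ∀ t, 0 < t → 0 < s t := fun t ht => Real.rpow_pos_of_pos ht _
  have hs2 : ∀ t, 0 < t → s t ^ 2 = t ^ (-r) := fun t ht => by
    rw [← Real.rpow_natCast, ← Real.rpow_mul ht.le]; congr 1; push_cast; ring
  have hds : ∀ t, 0 < t → HasDerivAt s (-ρ t * s t ^ 2) t := fun t ht => by
    have h := Real.hasDerivAt_rpow_const (x := t) (p := -(r / 2)) (Or.inl ht.ne')
    convert h using 1
    rw [hs2 t ht]
    simp only [ρ]
    rw [← neg_mul, mul_assoc, ← Real.rpow_add ht]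
    congr 2
    rw [hβ]; ring
  have hdθ : ∀ t, 0 < t → HasDerivAt θ (θ t * (c * s t)) t := fun t ht => by
    have h := ((Real.hasDerivAt_rpow_const (x := t) (p := β) (Or.inl ht.ne')).const_mul
      (c / β)).exp
    convert h using 1
    have : β - 1 = -(r / 2) := by rw [hβ]; ring
    simp only [θ, s, this]
    field_simp
  have hρlim : Tendsto ρ atTop (nhds 0) := by
    simpa using (tendsto_rpow_neg_atTop hβ0).const_mul (r / 2)
  have hρη : ∀ᶠ t in atTop, ρ t * (2 * η + ‖p‖ ^ 2) < c * η :=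
    (by simpa using hρlim.mul_const (2 * η + ‖p‖ ^ 2) :
      Tendsto (fun t => ρ t * (2 * η + ‖p‖ ^ 2)) atTop (nhds 0)).eventually
      (gt_mem_nhds (by positivity))
  obtain ⟨T, hT⟩ := eventually_atTop.1
    ((hρη.and (hρlim.eventually (gt_mem_nhds (by norm_num : (0 : ℝ) < 1 / 2)))).and
      (eventually_ge_atTop t₀))
  have hdW : ∀ t, t₀ ≤ t → HasDerivAt W _ t := fun t ht => by
    have h1 := hx1 t ht
    have h2 := hx2 t ht
    have h3 := hds t (ht₀.trans_le ht)
    have hf : HasDerivAt (fun t => f (x t)) (inner ℝ (f' (x t)) (x' t)) t := by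
      exact (hgrad (x t)).hasFDerivAt.comp_hasDerivAt t h1
    have hz := h1.sub_const p
    exact (((((hf.sub_const (f p)).add
      (((h3.pow 2).div_const 2).mul ((h1.inner ℝ h1).sub_const (‖p‖ ^ 2)))).add
      (((h3.pow 2).const_mul (c * δ / 2)).mul (hz.inner ℝ hz))).add
      ((h3.const_mul c).mul (hz.inner ℝ h2))).add ((h2.inner ℝ h2).div_const 2)).sub
      ((h3.pow 2).const_mul η)
  have hanti : AntitoneOn (fun t => θ t * W t) (Ici T) := by
    have hd : ∀ t ∈ Ici T, HasDerivAt (fun t => θ t * W t) _ t := fun t ht =>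
      (hdθ t (ht₀.trans_le (hT t ht).2)).mul (hdW t (hT t ht).2)
    refine antitoneOn_of_hasDerivWithinAt_nonpos (convex_Ici T)
      (fun t ht => (hd t ht).continuousAt.continuousWithinAt)
      (fun t ht => (hd t (interior_subset ht)).hasDerivWithinAt) fun t ht => ?_
    obtain ⟨⟨h1, h2⟩, h3⟩ := hT t (interior_subset ht)
    have ht0 := ht₀.trans_le h3
    have hF : f (x t) - f p ≤ inner ℝ (f' (x t)) (x t - p) := by
      have := hconv.add_inner_gradient_le (hgrad (x t)) p
      rw [← neg_sub, inner_neg_right] at this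
      linarith
    have ha : x'' t + (δ * s t) • x' t + f' (x t) + (s t ^ 2) • x t = 0 := by
      rw [hs2 t ht0, Real.rpow_neg ht0.le, ← one_div]
      simp only [s]
      rw [Real.rpow_neg ht0.le, ← div_eq_mul_inv]
      exact hode t h3
    have key := dissipation_nonpos hc hc2 hcδ hcδ' (hs0 t ht0)
      (show 0 < ρ t by have := Real.rpow_pos_of_pos ht0 (-β); positivity) h2.le h1.le hF ha
    have := mul_nonpos_of_nonneg_of_nonpos (Real.exp_pos (c / β * t ^ β)).le key
    refine le_trans (le_of_eq ?_) this
    simp only [W, θ, real_inner_comm (x' t) (x'' t), real_inner_comm (x t) (x' t),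
      real_inner_comm (x t - p) (x' t), Pi.pow_apply]
    push_cast
    ring
  have hlim : Tendsto (fun t : ℝ => θ T * W T * (t ^ r * Real.exp (-(c / β) * t ^ β)))
      atTop (nhds 0) := by
    simpa using (tendsto_rpow_mul_exp_neg_mul_rpow (div_pos hc hβ0) hβ0 r).const_mul (θ T * W T)
  filter_upwards [hlim.eventually (gt_mem_nhds hη), eventually_ge_atTop T] with t h1 h2
  have ht0 := ht₀.trans_le (hT t h2).2
  have h3 : θ t * W t ≤ θ T * W T := hanti self_mem_Ici h2 h2
  have hW : W t ≤ η * t ^ (-r) := by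
    have e1 : θ t * Real.exp (-(c / β) * t ^ β) = 1 := by
      simp only [θ]; rw [← Real.exp_add, neg_mul, add_neg_cancel, Real.exp_zero]
    have e2 : t ^ r * t ^ (-r) = 1 := by rw [← Real.rpow_add ht0, add_neg_cancel, Real.rpow_zero]
    have e3 := mul_le_mul_of_nonneg_right h3 (Real.exp_pos (-(c / β) * t ^ β)).le
    have e4 := mul_le_mul_of_nonneg_right h1.le (Real.rpow_pos_of_pos ht0 (-r)).le
    calc W t = θ t * W t * Real.exp (-(c / β) * t ^ β) := by
          linear_combination -W t * e1
      _ ≤ _ := e3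
      _ = θ T * W T * (t ^ r * Real.exp (-(c / β) * t ^ β)) * t ^ (-r) := by
          linear_combination -θ T * W T * Real.exp (-(c / β) * t ^ β) * e2
      _ ≤ _ := e4
  have hquad : 0 ≤ c * δ / 2 * s t ^ 2 * inner ℝ (x t - p) (x t - p)
      + c * s t * inner ℝ (x t - p) (x' t) + inner ℝ (x' t) (x' t) / 2 := by
    have q1 := real_inner_self_nonneg (F := H) (x := (c * s t) • (x t - p) + x' t)
    rw [inner_add_left, inner_add_right, inner_add_right, real_inner_smul_left,
      real_inner_smul_right, real_inner_smul_left, real_inner_smul_right,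
      real_inner_comm (x t - p) (x' t)] at q1
    have q2 : 0 ≤ c * s t ^ 2 * inner ℝ (x t - p) (x t - p) * (δ - c) :=
      mul_nonneg (mul_nonneg (by positivity) real_inner_self_nonneg) (by linarith)
    nlinarith
  simp only [W] at hW
  rw [hs2 t ht0] at hW hquad
  rw [real_inner_self_eq_norm_sq (x t)] at hW
  linarith

/-- Strong convergence towards the minimum norm solution for
`ẍ + (δ/t^{r/2}) ẋ + ∇f(x) + (1/t^r) x = 0`, `2/3 < r < 2` (Theorem 4.2). -/
theorem trigs_subcritical_strong_convergence
    {H : Type*} [NormedAddCommGroup H] [InnerProductSpace ℝ H] [CompleteSpace H]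
    (f : H → ℝ) (f' : H → H)
    (hconv : ConvexOn ℝ Set.univ f)
    (hgrad : ∀ y, HasGradientAt f (f' y) y)
    (hlip : ∀ s : Set H, Bornology.IsBounded s → ∃ L : NNReal, LipschitzOnWith L f' s)
    (xstar : H)
    (hxstar_min : ∀ y, f xstar ≤ f y)
    (hxstar_norm : ∀ y, (∀ z, f y ≤ f z) → ‖xstar‖ ≤ ‖y‖)
    (r δ t₀ : ℝ) (hr1 : 2 / 3 < r) (hr2 : r < 2) (hδ : 0 < δ) (ht₀ : 0 < t₀)
    (x x' x'' : ℝ → H)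
    (hx1 : ∀ t, t₀ ≤ t → HasDerivAt x (x' t) t)
    (hx2 : ∀ t, t₀ ≤ t → HasDerivAt x' (x'' t) t)
    (hode : ∀ t, t₀ ≤ t →
      x'' t + (δ / t ^ (r / 2)) • x' t + f' (x t) + (1 / t ^ r) • x t = 0) :
    Filter.liminf (fun t => ‖x t - xstar‖) atTop = 0 ∧
    ((∃ T, t₀ ≤ T ∧
        ((∀ t, T ≤ t → ‖x t‖ < ‖xstar‖) ∨ (∀ t, T ≤ t → ‖xstar‖ ≤ ‖x t‖))) →
      Tendsto x atTop (nhds xstar)) := by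
  have hcont : Continuous f := continuous_iff_continuousAt.2 fun y => (hgrad y).continuousAt
  have hr0 : 0 < r := by linarith
  have hx : Tendsto x atTop (nhds xstar) := by
    rw [Metric.tendsto_nhds]
    intro e he
    obtain ⟨η, hη, hclose⟩ := exists_norm_sub_lt_of_le_add hconv hcont hxstar_min hxstar_norm he
    have hlim : Tendsto (fun t : ℝ => (η / 2 + ‖xstar‖ ^ 2 / 2) * t ^ (-r)) atTop (nhds 0) := by
      simpa using (tendsto_rpow_neg_atTop hr0).const_mul (η / 2 + ‖xstar‖ ^ 2 / 2)
    filter_upwards [eventually_gap_le hconv hgrad xstar hr0 hr2 hδ ht₀ hx1 hx2 hode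
      (η := η / 4) (by positivity), hlim.eventually (gt_mem_nhds hη), eventually_gt_atTop 0]
      with t h1 h2 h3
    have hε : 0 < t ^ (-r) := Real.rpow_pos_of_pos h3 _
    rw [dist_eq_norm]
    refine hclose _ ?_ ?_
    · have : 0 ≤ t ^ (-r) * ‖x t‖ ^ 2 := by positivity
      linarith
    · have := hxstar_min (x t)
      refine le_of_mul_le_mul_left ?_ hε
      linarith
  refine ⟨?_, fun _ => hx⟩
  have := (hx.sub_const xstar).norm
  simp only [sub_self, norm_zero] at this
  exact this.liminf_eq
end

section
/- Let α > 3 and c > 0. Let H be a real Hilbert space and f : H → ℝ convex and differentiable with ∇f Lipschitz continuous on bounded sets and argmin f nonempty. Let (x_k)_{k ≥ 0} be a sequence in H satisfying, for all k ≥ 1, the implicit recursion (x_{k+1} − 2x_k + x_{k−1}) + (α/k)(x_k − x_{k−1}) + ∇f(x_{k+1}) + (c/k²) x_k = 0. Then for every s ∈ [1/2, 1): the series Σ_{k ≥ 1} k^{2s−1}(f(x_k) − min f), Σ_{k ≥ 1} k^{2s−1}‖x_k − x_{k−1}‖², and Σ_{k ≥ 1} k^{2s}‖∇f(x_k)‖²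 are all convergent. -/
open Filter Set

theorem energy_identity {H : Type*} [NormedAddCommGroup H] [InnerProductSpace ℝ H]
    (p g X a q : H) (K l μ c : ℝ) (hK : K ≠ 0)
    (hq : q = (1 - (1 + l + μ) / K) • p - g - (c / K ^ 2) • X) :
    (‖K • q + l • (X - a)‖ ^ 2 / 2 + μ * l / 2 * ‖X - a‖ ^ 2 + c / 2 * ‖X + q‖ ^ 2) -
      (‖(K - 1) • p + l • (X - p - a)‖ ^ 2 / 2 + μ * l / 2 * ‖X - p - a‖ ^ 2 + c / 2 * ‖X‖ ^ 2) =
    -K * (K - l) * inner ℝ g q - K * l * inner ℝ g (X + q - a)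
      - μ * (K - (1 + l + μ)) * ‖p‖ ^ 2 + μ * K * inner ℝ p g + μ * (c / K) * inner ℝ p X
      - μ * l / 2 * ‖p‖ ^ 2 + c / 2 * ‖q‖ ^ 2 - c * l / K * inner ℝ X (X - a)
      - ‖K • g + (μ • p + (c / K) • X)‖ ^ 2 / 2 := by
  subst hq
  simp only [← real_inner_self_eq_norm_sq, inner_add_left, inner_add_right, inner_sub_left,
    inner_sub_right, real_inner_smul_left, real_inner_smul_right]
  rw [real_inner_comm p g, real_inner_comm p X, real_inner_comm p a, real_inner_comm g X,
    real_inner_comm g a, real_inner_comm X a]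
  field_simp
  ring

theorem norm_sub_sub_sq_le {H : Type*} [NormedAddCommGroup H] [InnerProductSpace ℝ H]
    (u v w : H) : ‖u - v - w‖ ^ 2 ≤ 3 * (‖u‖ ^ 2 + ‖v‖ ^ 2 + ‖w‖ ^ 2) := by
  have h : ‖u - v - w‖ ≤ ‖u‖ + ‖v‖ + ‖w‖ := by
    linarith [norm_sub_le (u - v) w, norm_sub_le u v]
  have h' := pow_le_pow_left₀ (norm_nonneg _) h 2
  nlinarith [sq_nonneg (‖u‖ - ‖v‖), sq_nonneg (‖v‖ - ‖w‖), sq_nonneg (‖u‖ - ‖w‖)]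

theorem neg_norm_add_add_sq_le {H : Type*} [NormedAddCommGroup H] [InnerProductSpace ℝ H]
    (u v w : H) : -‖u + (v + w)‖ ^ 2 / 2 ≤ -‖u‖ ^ 2 / 4 + ‖v‖ ^ 2 + ‖w‖ ^ 2 := by
  have h : ‖u‖ ≤ ‖u + (v + w)‖ + (‖v‖ + ‖w‖) := by
    have := norm_sub_le (u + (v + w)) (v + w)
    rw [add_sub_cancel_right] at this
    linarith [norm_add_le v w]
  have h' := pow_le_pow_left₀ (norm_nonneg _) h 2
  nlinarith [sq_nonneg (‖u + (v + w)‖ - (‖v‖ + ‖w‖)), sq_nonneg (‖v‖ - ‖w‖)]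

set_option maxHeartbeats 1000000 in
/-- One-step decrease of the discrete energy, where `p` and `q` are consecutive increments of the
iteration, `X` is the point between them and `g` is the gradient at `X + q`. -/
theorem energy_decrease {H : Type*} [NormedAddCommGroup H] [InnerProductSpace ℝ H]
    (p g X a q : H) (K l μ c F F' : ℝ) (hl : 2 < l) (hμ : 0 < μ) (hc : 0 < c) (hK : 1 ≤ K)
    (hKα : 1 + l + μ ≤ K)
    (hp : μ * (1 + l + μ) + 3 * μ ^ 2 + 2 * μ ^ 2 * c / l + 3 * c / 2 ≤ μ * K / 2)
    (hg : 24 * c ≤ K) (hX : 3 * c ^ 3 / 2 + c ^ 2 ≤ 3 * (c * l) / 8 * K)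
    (hF' : 0 ≤ F') (hFq : F' - F ≤ inner ℝ g q) (hFa : F' ≤ inner ℝ g (X + q - a))
    (hq : q = (1 - (1 + l + μ) / K) • p - g - (c / K ^ 2) • X) :
    (‖K • q + l • (X - a)‖ ^ 2 / 2 + μ * l / 2 * ‖X - a‖ ^ 2 + c / 2 * ‖X + q‖ ^ 2)
        + (K + 1) * (K + 1 - l) * F'
        + ((l - 2) * K * F' + μ * K / 2 * ‖p‖ ^ 2 + K ^ 2 / 16 * ‖g‖ ^ 2) ≤
      (‖(K - 1) • p + l • (X - p - a)‖ ^ 2 / 2 + μ * l / 2 * ‖X - p - a‖ ^ 2 + c / 2 * ‖X‖ ^ 2)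
        + K * (K - l) * F + c * l / 2 * ‖a‖ ^ 2 * K⁻¹ := by
  have hK0 : 0 < K := by linarith
  have hid := energy_identity p g X a q K l μ c hK0.ne' hq
  have h1 : K * (K - l) * (F' - F) ≤ K * (K - l) * inner ℝ g q :=
    mul_le_mul_of_nonneg_left hFq (mul_nonneg hK0.le (by linarith))
  have h2 : K * l * F' ≤ K * l * inner ℝ g (X + q - a) :=
    mul_le_mul_of_nonneg_left hFa (by positivity)
  have h3 : μ * K * inner ℝ p g ≤ 2 * μ ^ 2 * ‖p‖ ^ 2 + K ^ 2 / 8 * ‖g‖ ^ 2 := by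
    have := sq_nonneg ‖(4 * μ) • p - K • g‖
    rw [norm_sub_sq_real, norm_smul, norm_smul, mul_pow, mul_pow, Real.norm_eq_abs,
      Real.norm_eq_abs, sq_abs, sq_abs, real_inner_smul_left, real_inner_smul_right] at this
    nlinarith
  have h4 : μ * (c / K) * inner ℝ p X ≤
      2 * μ ^ 2 * c / l * ‖p‖ ^ 2 + c * l / 8 * (K⁻¹ * ‖X‖ ^ 2) := by
    have := sq_nonneg ‖(4 * μ) • p - l • X‖
    rw [norm_sub_sq_real, norm_smul, norm_smul, mul_pow, mul_pow, Real.norm_eq_abs,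
      Real.norm_eq_abs, sq_abs, sq_abs, real_inner_smul_left, real_inner_smul_right] at this
    have h := mul_nonneg (show 0 ≤ c / (8 * K * l) by positivity) this
    have e : c / (8 * K * l) * ((4 * μ) ^ 2 * ‖p‖ ^ 2 - 2 * (4 * μ * (l * inner ℝ p X))
        + l ^ 2 * ‖X‖ ^ 2) = K⁻¹ * (2 * μ ^ 2 * c / l * ‖p‖ ^ 2) - μ * (c / K) * inner ℝ p X
        + c * l / 8 * (K⁻¹ * ‖X‖ ^ 2) := by
      field_simp
      ring
    have h' : K⁻¹ * (2 * μ ^ 2 * c / l * ‖p‖ ^ 2) ≤ 1 * (2 * μ ^ 2 * c / l * ‖p‖ ^ 2) :=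
      mul_le_mul_of_nonneg_right (inv_le_one_of_one_le₀ hK) (by positivity)
    linarith
  have hX4 : ‖(c / K ^ 2) • X‖ ^ 2 ≤ c ^ 2 * K⁻¹ * (K⁻¹ * ‖X‖ ^ 2) := by
    rw [norm_smul, mul_pow, Real.norm_eq_abs, sq_abs]
    have : (c / K ^ 2) ^ 2 ≤ (c / K) ^ 2 := by
      gcongr
      nlinarith
    calc _ ≤ (c / K) ^ 2 * ‖X‖ ^ 2 := by gcongr
      _ = _ := by field_simp
  have hX2 : ‖(c / K) • X‖ ^ 2 = c ^ 2 * K⁻¹ * (K⁻¹ * ‖X‖ ^ 2) := by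
    rw [norm_smul, mul_pow, Real.norm_eq_abs, sq_abs]
    field_simp
  have h5 : ‖q‖ ^ 2 ≤ 3 * (‖p‖ ^ 2 + ‖g‖ ^ 2 + c ^ 2 * K⁻¹ * (K⁻¹ * ‖X‖ ^ 2)) := by
    have hr : ‖(1 - (1 + l + μ) / K) • p‖ ^ 2 ≤ ‖p‖ ^ 2 := by
      have : (1 + l + μ) / K ≤ 1 := (div_le_one hK0).2 hKα
      have h0 : 0 ≤ (1 + l + μ) / K := by positivity
      rw [norm_smul, Real.norm_eq_abs, abs_of_nonneg (by linarith)]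
      gcongr
      exact mul_le_of_le_one_left (norm_nonneg _) (by linarith)
    rw [hq]
    have := norm_sub_sub_sq_le ((1 - (1 + l + μ) / K) • p) g ((c / K ^ 2) • X)
    linarith
  have h6 : -(c * l / K * inner ℝ X (X - a)) ≤
      -(c * l / 2 * (K⁻¹ * ‖X‖ ^ 2)) + c * l / 2 * ‖a‖ ^ 2 * K⁻¹ := by
    have h := sq_nonneg ‖X - a‖
    rw [norm_sub_sq_real] at h
    rw [inner_sub_right, real_inner_self_eq_norm_sq]
    have := mul_nonneg (show 0 ≤ c * l / 2 * K⁻¹ by positivity) h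
    rw [div_eq_mul_inv]
    linarith
  have h7 := neg_norm_add_add_sq_le (K • g) (μ • p) ((c / K) • X)
  rw [hX2, norm_smul, norm_smul, mul_pow, mul_pow, Real.norm_eq_abs, Real.norm_eq_abs, sq_abs,
    sq_abs] at h7
  have hp' := mul_le_mul_of_nonneg_right hp (sq_nonneg ‖p‖)
  have hg' : 24 * c * ‖g‖ ^ 2 ≤ K ^ 2 * ‖g‖ ^ 2 := by
    gcongr
    nlinarith
  have hX' : (3 * c ^ 3 / 2 + c ^ 2) * K⁻¹ * (K⁻¹ * ‖X‖ ^ 2) ≤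
      3 * (c * l) / 8 * (K⁻¹ * ‖X‖ ^ 2) := by
    refine mul_le_mul_of_nonneg_right ?_ (by positivity)
    rwa [← div_eq_mul_inv, div_le_iff₀ hK0]
  have h5' := mul_le_mul_of_nonneg_left h5 (show 0 ≤ c / 2 by positivity)
  have hpl : 0 ≤ μ * l / 2 * ‖p‖ ^ 2 := by positivity
  have hlF : 0 ≤ (l - 1) * F' := mul_nonneg (by linarith) hF'
  linarith

theorem ConvexOn.inner_gradient_le {H : Type*} [NormedAddCommGroup H] [InnerProductSpace ℝ H]
    [CompleteSpace H] {f : H → ℝ} (hf : ConvexOn ℝ Set.univ f) {g u : H}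
    (hg : HasGradientAt f g u) (v : H) : inner ℝ g (v - u) ≤ f v - f u := by
  have hline : HasDerivAt (fun t : ℝ => AffineMap.lineMap u v t) (v - u) (0 : ℝ) :=
    AffineMap.hasDerivAt_lineMap
  have hg' : HasFDerivAt f (InnerProductSpace.toDual ℝ H g) (AffineMap.lineMap u v (0 : ℝ)) := by
    simpa using hg.hasFDerivAt
  have hd := hg'.comp_hasDerivAt (0 : ℝ) hline
  have hc : ConvexOn ℝ Set.univ (f ∘ (AffineMap.lineMap u v : ℝ →ᵃ[ℝ] H)) := by
    simpa using hf.comp_affineMap (AffineMap.lineMap u v : ℝ →ᵃ[ℝ] H)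
  have := hc.le_slope_of_hasDerivAt (Set.mem_univ 0) (Set.mem_univ 1) one_pos hd
  simpa [slope] using this

theorem summable_of_add_le_add {E D b : ℕ → ℝ} (hE : ∀ k, 0 ≤ E k) (hD : ∀ k, 0 ≤ D k)
    (hb0 : ∀ k, 0 ≤ b k) (hb : Summable b) (h : ∀ k, E (k + 1) + D k ≤ E k + b k) :
    Summable D := by
  have hs : ∀ n, E n + ∑ k ∈ Finset.range n, D k ≤ E 0 + ∑ k ∈ Finset.range n, b k := by
    intro n
    induction n with
    | zero => simp
    | succ n ih =>
      rw [Finset.sum_range_succ, Finset.sum_range_succ]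
      linarith [h n]
  refine summable_of_sum_range_le (c := E 0 + ∑' k, b k) hD fun n => ?_
  linarith [hs n, hE n, hb.sum_le_tsum (Finset.range n) fun k _ => hb0 k]

/-- A sequence whose increments are at most `C / k - D k` satisfies `∑ k ^ r * D k < ∞` for every
`r < 0`. -/
theorem summable_rpow_mul_of_descent {E D : ℕ → ℝ} {C r : ℝ} {N : ℕ} (hN : 1 ≤ N) (hC : 0 ≤ C)
    (hr : r < 0) (hE : ∀ k, N ≤ k → 0 ≤ E k) (hD : ∀ k, N ≤ k → 0 ≤ D k)
    (h : ∀ k, N ≤ k → E (k + 1) + D k ≤ E k + C * (k : ℝ)⁻¹) :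
    Summable fun k : ℕ => (k : ℝ) ^ r * D k := by
  rw [← summable_nat_add_iff N]
  refine summable_of_add_le_add (E := fun k => ((k + N : ℕ) : ℝ) ^ r * E (k + N))
    (b := fun k => C * ((k + N : ℕ) : ℝ) ^ (r - 1)) (fun k => ?_) (fun k => ?_) (fun k => ?_) ?_
    fun k => ?_
  · exact mul_nonneg (by positivity) (hE _ (Nat.le_add_left _ _))
  · exact mul_nonneg (by positivity) (hD _ (Nat.le_add_left _ _))
  · positivity
  · exact ((summable_nat_add_iff N).2 (Real.summable_nat_rpow.2 (by linarith))).mul_left C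
  · have hk : N ≤ k + N := Nat.le_add_left _ _
    have hpos : (0 : ℝ) < ((k + N : ℕ) : ℝ) := by exact_mod_cast hN.trans hk
    have hw : ((k + 1 + N : ℕ) : ℝ) ^ r ≤ ((k + N : ℕ) : ℝ) ^ r :=
      Real.rpow_le_rpow_of_nonpos hpos (by push_cast; linarith) hr.le
    have he : 0 ≤ E (k + 1 + N) := hE _ (by omega)
    have h1 := mul_le_mul_of_nonneg_right hw he
    have h2 := mul_le_mul_of_nonneg_left (h _ hk) (Real.rpow_nonneg hpos.le r)
    rw [Real.rpow_sub_one hpos.ne', div_eq_mul_inv]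
    rw [show k + N + 1 = k + 1 + N by omega] at h2
    linarith

/-- Summability estimates for the inertial proximal algorithm with Tikhonov
regularization (IPATRE) (Theorem 5.1 (ii)). -/
theorem ipatre_summability
    {H : Type*} [NormedAddCommGroup H] [InnerProductSpace ℝ H] [CompleteSpace H]
    (f : H → ℝ) (f' : H → H)
    (hconv : ConvexOn ℝ Set.univ f)
    (hgrad : ∀ y, HasGradientAt f (f' y) y)
    (hlip : ∀ s : Set H, Bornology.IsBounded s → ∃ L : NNReal, LipschitzOnWith L f' s)
    (xbar : H) (hmin : ∀ y, f xbar ≤ f y)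
    (α c : ℝ) (hα : 3 < α) (hc : 0 < c)
    (x : ℕ → H)
    (hrec : ∀ k : ℕ, 1 ≤ k →
      (x (k + 1) - (2 : ℝ) • x k + x (k - 1)) + (α / k) • (x k - x (k - 1)) +
        f' (x (k + 1)) + (c / (k : ℝ) ^ 2) • x k = 0) :
    ∀ s : ℝ, 1 / 2 ≤ s → s < 1 →
      Summable (fun k : ℕ => (k : ℝ) ^ (2 * s - 1) * (f (x k) - f xbar)) ∧
      Summable (fun k : ℕ => (k : ℝ) ^ (2 * s - 1) * ‖x k - x (k - 1)‖ ^ 2) ∧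
      Summable (fun k : ℕ => (k : ℝ) ^ (2 * s) * ‖f' (x k)‖ ^ 2) := by
  intro s _ hs
  obtain ⟨l, μ, hl, hμ, hαlμ⟩ : ∃ l μ : ℝ, 2 < l ∧ 0 < μ ∧ α = 1 + l + μ :=
    ⟨(α + 1) / 2, (α - 3) / 2, by linarith, by linarith, by ring⟩
  have hev (r : ℝ) : ∀ᶠ k : ℕ in atTop, r ≤ k :=
    tendsto_natCast_atTop_atTop.eventually_ge_atTop r
  obtain ⟨N, hN⟩ := eventually_atTop.1 ((eventually_ge_atTop 1).and <| (hev α).and <|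
    (hev ((μ * (1 + l + μ) + 3 * μ ^ 2 + 2 * μ ^ 2 * c / l + 3 * c / 2) / (μ / 2))).and <|
    (hev (24 * c)).and (hev ((3 * c ^ 3 / 2 + c ^ 2) / (3 * (c * l) / 8))))
  have hN1 : 1 ≤ N := (hN N le_rfl).1
  have hF (k : ℕ) : 0 ≤ f (x k) - f xbar := sub_nonneg.2 (hmin _)
  let E : ℕ → ℝ := fun k =>
    ‖((k : ℝ) - 1) • (x k - x (k - 1)) + l • (x k - (x k - x (k - 1)) - xbar)‖ ^ 2 / 2
      + μ * l / 2 * ‖x k - (x k - x (k - 1)) - xbar‖ ^ 2 + c / 2 * ‖x k‖ ^ 2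
      + k * (k - l) * (f (x k) - f xbar)
  let D : ℕ → ℝ := fun k => (l - 2) * k * (f (x (k + 1)) - f xbar)
    + μ * k / 2 * ‖x k - x (k - 1)‖ ^ 2 + (k : ℝ) ^ 2 / 16 * ‖f' (x (k + 1))‖ ^ 2
  have hDk (k : ℕ) : D k = (l - 2) * k * (f (x (k + 1)) - f xbar)
    + μ * k / 2 * ‖x k - x (k - 1)‖ ^ 2 + (k : ℝ) ^ 2 / 16 * ‖f' (x (k + 1))‖ ^ 2 := rfl
  have hDF (k : ℕ) : 0 ≤ (l - 2) * k * (f (x (k + 1)) - f xbar) :=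
    mul_nonneg (mul_nonneg (by linarith) k.cast_nonneg) (hF _)
  have hDx (k : ℕ) : 0 ≤ μ * k / 2 * ‖x k - x (k - 1)‖ ^ 2 := by positivity
  have hDg (k : ℕ) : 0 ≤ (k : ℝ) ^ 2 / 16 * ‖f' (x (k + 1))‖ ^ 2 := by positivity
  have hsum : Summable fun k : ℕ => (k : ℝ) ^ (2 * s - 2) * D k := by
    refine summable_rpow_mul_of_descent (E := E) (C := c * l / 2 * ‖xbar‖ ^ 2) hN1 (by positivity)
      (by linarith) (fun k hk => ?_) (fun k _ => by linarith [hDk k, hDF k, hDx k, hDg k]) fun k hk => ?_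
    · have h0 : 0 ≤ (k : ℝ) * (k - l) * (f (x k) - f xbar) :=
        mul_nonneg (mul_nonneg k.cast_nonneg (by linarith [(hN k hk).2.1])) (hF k)
      positivity
    · obtain ⟨h1, h2, h3, h4, h5⟩ := hN k hk
      rw [div_le_iff₀ (by positivity)] at h3 h5
      have hq : x (k + 1) - x k = (1 - (1 + l + μ) / k) • (x k - x (k - 1)) - f' (x (k + 1))
          - (c / (k : ℝ) ^ 2) • x k := by
        rw [← hαlμ, ← sub_eq_zero, ← hrec k h1]
        module
      have hgq := hconv.inner_gradient_le (hgrad (x (k + 1))) (x k)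
      have hga := hconv.inner_gradient_le (hgrad (x (k + 1))) xbar
      have key := energy_decrease (x k - x (k - 1)) (f' (x (k + 1))) (x k) xbar (x (k + 1) - x k)
        k l μ c (f (x k) - f xbar) (f (x (k + 1)) - f xbar) hl hμ hc (by exact_mod_cast h1)
        (hαlμ ▸ h2) (by linarith) h4 (by linarith) (hF _)
        (by rw [← neg_sub (x k), inner_neg_right]; linarith)
        (by rw [add_sub_cancel, ← neg_sub xbar, inner_neg_right]; linarith) hq
      simp only [E, D, Nat.add_sub_cancel, Nat.cast_add, Nat.cast_one, add_sub_cancel_right,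
        sub_sub_cancel]
      simp only [add_sub_cancel, sub_sub_cancel] at key
      exact key
  have hw {k : ℕ} (hk : 1 ≤ k) : (k : ℝ) ^ (2 * s - 1) = (k : ℝ) ^ (2 * s - 2) * k := by
    rw [← Real.rpow_add_one (by positivity)]
    ring_nf
  have hw' {k : ℕ} (hk : 1 ≤ k) : (k : ℝ) ^ (2 * s) = (k : ℝ) ^ (2 * s - 2) * k ^ 2 := by
    rw [pow_two, ← mul_assoc, ← hw hk, ← Real.rpow_add_one (by positivity)]
    ring_nf
  have hmono {k : ℕ} (hk : 1 ≤ k) : ((k + 1 : ℕ) : ℝ) ^ (2 * s - 2) ≤ (k : ℝ) ^ (2 * s - 2) :=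
    Real.rpow_le_rpow_of_nonpos (by positivity) (by push_cast; linarith) (by linarith)
  have hdom {u : ℕ → ℝ} (C : ℝ) (h0 : ∀ k, 0 ≤ u k)
      (h : ∀ k : ℕ, 1 ≤ k → u k ≤ (k : ℝ) ^ (2 * s - 2) * (C * D k)) : Summable u := by
    rw [← summable_nat_add_iff 1]
    refine .of_nonneg_of_le (fun k => h0 _) (fun k => h (k + 1) (by omega)) ?_
    refine (summable_nat_add_iff (f := fun k : ℕ => (k : ℝ) ^ (2 * s - 2) * (C * D k)) 1).2 ?_
    simpa only [mul_left_comm] using hsum.mul_left C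
  refine ⟨(summable_nat_add_iff 1).1 (hdom (2 / (l - 2)) (fun k => ?_) fun k hk => ?_),
    hdom (2 / μ) (fun k => by positivity) fun k hk => ?_,
    (summable_nat_add_iff 1).1 (hdom 64 (fun k => by positivity) fun k hk => ?_)⟩
  · exact mul_nonneg (by positivity) (hF _)
  · have hl' : 0 < l - 2 := by linarith
    have hk' : (1 : ℝ) ≤ k := by exact_mod_cast hk
    rw [hw (by omega), mul_assoc]
    refine mul_le_mul (hmono hk) ?_ (mul_nonneg (by positivity) (hF _)) (by positivity)
    calc ((k + 1 : ℕ) : ℝ) * (f (x (k + 1)) - f xbar)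
        ≤ (2 * k) * (f (x (k + 1)) - f xbar) :=
          mul_le_mul_of_nonneg_right (by push_cast; linarith) (hF _)
      _ = 2 / (l - 2) * ((l - 2) * k * (f (x (k + 1)) - f xbar)) := by field_simp
      _ ≤ 2 / (l - 2) * D k := by
          gcongr
          linarith [hDk k, hDx k, hDg k]
  · rw [hw hk, mul_assoc]
    refine mul_le_mul_of_nonneg_left ?_ (by positivity)
    calc (k : ℝ) * ‖x k - x (k - 1)‖ ^ 2
        = 2 / μ * (μ * k / 2 * ‖x k - x (k - 1)‖ ^ 2) := by field_simp
      _ ≤ 2 / μ * D k := by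
          gcongr
          linarith [hDk k, hDF k, hDg k]
  · have hk' : (1 : ℝ) ≤ k := by exact_mod_cast hk
    rw [hw' (by omega), mul_assoc]
    refine mul_le_mul (hmono hk) ?_ (by positivity) (by positivity)
    calc ((k + 1 : ℕ) : ℝ) ^ 2 * ‖f' (x (k + 1))‖ ^ 2
        ≤ (2 * k) ^ 2 * ‖f' (x (k + 1))‖ ^ 2 := by
          gcongr
          push_cast
          linarith
      _ = 64 * ((k : ℝ) ^ 2 / 16 * ‖f' (x (k + 1))‖ ^ 2) := by ring
      _ ≤ 64 * D k := by
          gcongr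
          linarith [hDk k, hDF k, hDx k]
end

section
/- Let H be a real Hilbert space, f : H → ℝ convex and differentiable with argmin f nonempty, and let x* be the element of minimum norm of argmin f. Let (x_k) be a bounded sequence in H such that f(x_k) → min f as k → ∞ and ‖x_k‖ ≤ ‖x*‖ for all k sufficiently large. Then x_k converges strongly to x*, i.e. ‖x_k − x*‖ → 0 as k → ∞. -/
open Filter Set

/-- A nonempty closed convex set in a Hilbert space has a point `p` of minimal norm, which
satisfies the Pythagorean inequality `‖w - p‖² ≤ ‖w‖² - ‖p‖²` for all `w` in the set. -/
lemma exists_mem_norm_sub_sq_le {H : Type*} [NormedAddCommGroup H] [InnerProductSpace ℝ H]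
    [CompleteSpace H] {K : Set H} (hne : K.Nonempty) (hcl : IsClosed K) (hK : Convex ℝ K) :
    ∃ p ∈ K, ∀ w ∈ K, ‖w - p‖ ^ 2 ≤ ‖w‖ ^ 2 - ‖p‖ ^ 2 := by
  obtain ⟨p, hp, hmin⟩ := exists_norm_eq_iInf_of_complete_convex hne hcl.isComplete hK 0
  refine ⟨p, hp, fun w hw => ?_⟩
  have h := (norm_eq_iInf_iff_real_inner_le_zero hK hp).1 hmin w hw
  have hw' : ‖w‖ ^ 2 = ‖p + (w - p)‖ ^ 2 := by rw [add_sub_cancel]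
  rw [norm_add_sq_real] at hw'
  rw [zero_sub, inner_neg_left] at h
  linarith

/-- A sequence with bounded norms such that `‖p k - p n‖² ≤ ‖p k‖² - ‖p n‖²` for all `n ≤ k`
is Cauchy. -/
lemma cauchySeq_of_norm_sub_sq_le {H : Type*} [NormedAddCommGroup H] {p : ℕ → H} {R : ℝ}
    (hR : ∀ n, ‖p n‖ ^ 2 ≤ R)
    (hp : ∀ n k, n ≤ k → ‖p k - p n‖ ^ 2 ≤ ‖p k‖ ^ 2 - ‖p n‖ ^ 2) : CauchySeq p := by
  have hmono : Monotone fun n => ‖p n‖ ^ 2 := fun n k hnk => by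
    linarith [hp n k hnk, sq_nonneg ‖p k - p n‖]
  have hlim := tendsto_atTop_ciSup hmono ⟨R, by rintro _ ⟨n, rfl⟩; exact hR n⟩
  refine Metric.cauchySeq_iff'.2 fun ε hε => ?_
  obtain ⟨N, hN⟩ := Metric.cauchySeq_iff'.1 hlim.cauchySeq (ε ^ 2) (by positivity)
  refine ⟨N, fun n hn => ?_⟩
  rw [dist_eq_norm]
  refine lt_of_pow_lt_pow_left₀ 2 hε.le ((hp N n hn).trans_lt ?_)
  exact (le_abs_self _).trans_lt (hN n hn)

/-- A bounded minimizing sequence whose norms are eventually bounded by `‖x*‖`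
converges strongly to the minimum norm minimizer `x*` (argument of Case II). -/
theorem minimizing_sequence_strong_convergence_min_norm
    {H : Type*} [NormedAddCommGroup H] [InnerProductSpace ℝ H] [CompleteSpace H]
    (f : H → ℝ) (f' : H → H)
    (hconv : ConvexOn ℝ Set.univ f)
    (hgrad : ∀ y, HasGradientAt f (f' y) y)
    (xstar : H)
    (hxstar_min : ∀ y, f xstar ≤ f y)
    (hxstar_norm : ∀ y, (∀ z, f y ≤ f z) → ‖xstar‖ ≤ ‖y‖)
    (x : ℕ → H)
    (hbdd : Bornology.IsBounded (Set.range x))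
    (hvals : Tendsto (fun k => f (x k)) atTop (nhds (f xstar)))
    (hnorm : ∃ N : ℕ, ∀ k, N ≤ k → ‖x k‖ ≤ ‖xstar‖) :
    Tendsto x atTop (nhds xstar) := by
  have hcont : Continuous f :=
    continuous_iff_continuousAt.2 fun y => (hgrad y).continuousAt
  have hstar_mem : ∀ n : ℕ, f xstar ≤ f xstar + 1 / ((n : ℝ) + 1) := fun n => by
    have : 0 < 1 / ((n : ℝ) + 1) := by positivity
    linarith
  have hex : ∀ n : ℕ, ∃ p, f p ≤ f xstar + 1 / ((n : ℝ) + 1) ∧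
      ∀ w, f w ≤ f xstar + 1 / ((n : ℝ) + 1) → ‖w - p‖ ^ 2 ≤ ‖w‖ ^ 2 - ‖p‖ ^ 2 := fun n =>
    exists_mem_norm_sub_sq_le (K := {y | f y ≤ f xstar + 1 / ((n : ℝ) + 1)})
      ⟨xstar, hstar_mem n⟩ (isClosed_le hcont continuous_const)
      (by simpa using hconv.convex_le (f xstar + 1 / ((n : ℝ) + 1)))
  choose p hp_mem hp_sq using hex
  have hp_le : ∀ n, ‖p n‖ ^ 2 ≤ ‖xstar‖ ^ 2 := fun n => by
    linarith [hp_sq n xstar (hstar_mem n), sq_nonneg ‖xstar - p n‖]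
  have hcauchy : CauchySeq p := cauchySeq_of_norm_sub_sq_le hp_le fun n k hnk =>
    hp_sq n (p k) ((hp_mem k).trans (by gcongr))
  obtain ⟨q, hq⟩ := cauchySeq_tendsto_of_complete hcauchy
  have hq_min : f q ≤ f xstar := by
    have hlim := (tendsto_one_div_add_atTop_nhds_zero_nat (𝕜 := ℝ)).const_add (f xstar)
    rw [add_zero] at hlim
    exact le_of_tendsto_of_tendsto' ((hcont.tendsto q).comp hq) hlim hp_mem
  have hq_norm : ‖xstar‖ ≤ ‖q‖ := hxstar_norm q fun z => hq_min.trans (hxstar_min z)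
  have hsub : Tendsto (fun n => ‖xstar‖ ^ 2 - ‖p n‖ ^ 2) atTop (nhds (‖xstar‖ ^ 2 - ‖q‖ ^ 2)) :=
    (hq.norm.pow 2).const_sub _
  have hgap : ‖xstar‖ ^ 2 - ‖q‖ ^ 2 ≤ 0 := sub_nonpos.2 (by gcongr)
  refine Metric.tendsto_atTop'.2 fun ε hε => ?_
  obtain ⟨n, hn⟩ := (hsub.eventually_lt_const
    (hgap.trans_lt (show (0 : ℝ) < (ε / 2) ^ 2 by positivity))).exists
  obtain ⟨N, hN⟩ := hnorm
  obtain ⟨M, hM⟩ := eventually_atTop.1 (hvals.eventually_lt_const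
    (show f xstar < f xstar + 1 / ((n : ℝ) + 1) from lt_add_of_pos_right _ (by positivity)))
  have hclose : ∀ w, f w ≤ f xstar + 1 / ((n : ℝ) + 1) → ‖w‖ ≤ ‖xstar‖ →
      dist w (p n) < ε / 2 := fun w hw hw_norm => by
    rw [dist_eq_norm]
    have hw_sq : ‖w‖ ^ 2 ≤ ‖xstar‖ ^ 2 := by gcongr
    exact lt_of_pow_lt_pow_left₀ 2 (by positivity) (by linarith [hp_sq n w hw])
  refine ⟨max N M, fun k hk => ?_⟩
  calc dist (x k) xstar ≤ dist (x k) (p n) + dist xstar (p n) := dist_triangle_right _ _ _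
    _ < ε / 2 + ε / 2 := add_lt_add
        (hclose _ (hM k ((le_max_right _ _).trans hk.le)).le (hN k ((le_max_left _ _).trans hk.le)))
        (hclose _ (hstar_mem n) le_rfl)
    _ = ε := add_halves ε
end
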